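/- arXiv:2106.03102 — 2 statements merged into one kernel-verified Lean document; each statement's English description precedes it below -/
import Mathlib

section
/- There is no self-dual generalized bent function f : V_n → Z_{p^k} when p ≡ 3 (mod 4) and n is odd. -/
open Finset

/-- `chr m z = ζ_m ^ z`, the additive character sending `z ∈ ℤ/m` to `e^{2πi z/m}`. -/
noncomputable def chr (m : ℕ) (z : ZMod m) : ℂ :=
  Complex.exp (2 * Real.pi * Complex.I * (z.val : ℂ) / (m : ℂ))

/-- The Walsh transform of a generalized p-ary function `f : V_n → ℤ_{p^k}`,
where `V_n = (ℤ/p)^n` with the usual dot product. -/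
noncomputable def walsh (p k n : ℕ) [NeZero p] [NeZero (p ^ k)]
    (f : (Fin n → ZMod p) → ZMod (p ^ k)) (a : Fin n → ZMod p) : ℂ :=
  ∑ x : Fin n → ZMod p, chr (p ^ k) (f x) * chr p (-(∑ i, a i * x i))

/-- `ξ = 1` if `p ≡ 1 (mod 4)` or `n` even, `ξ = √-1` otherwise. -/
noncomputable def xi (p n : ℕ) : ℂ :=
  if p % 4 = 1 ∨ Even n then 1 else Complex.I

lemma isIntegral_nat (j : ℕ) : IsIntegral ℤ (j : ℂ) := by
  simpa using isIntegral_algebraMap (R := ℤ) (A := ℂ) (x := (j : ℤ))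

lemma chr_eq (m : ℕ) [NeZero m] (z : ZMod m) : chr m z = ZMod.stdAddChar z := by
  rw [ZMod.stdAddChar_apply, ZMod.toCircle_apply, chr]

lemma chr_pow (m : ℕ) [NeZero m] (z : ZMod m) : chr m z ^ m = 1 := by
  rw [chr_eq, ← AddChar.map_nsmul_eq_pow]
  simp

lemma chr_integral (m : ℕ) [NeZero m] (z : ZMod m) : IsIntegral ℤ (chr m z) := by
  apply IsIntegral.of_pow (Nat.pos_of_ne_zero (NeZero.ne m))
  rw [chr_pow]
  exact isIntegral_one

lemma sum_orth (p n : ℕ) [NeZero p] (hp : p.Prime) (y : Fin n → ZMod p) :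
    ∑ a : Fin n → ZMod p, chr p (∑ i, a i * y i) = if y = 0 then (p : ℂ) ^ n else 0 := by
  have := Fact.mk hp
  have h1 : ∀ a : Fin n → ZMod p, chr p (∑ i, a i * y i)
      = ∏ i, (ZMod.stdAddChar (a i * y i) : ℂ) := by
    intro a
    rw [chr_eq]
    have := map_prod (AddChar.toMonoidHom (ZMod.stdAddChar (N := p)))
      (fun i => Multiplicative.ofAdd (a i * y i)) univ
    rw [← ofAdd_sum] at this
    exact this
  simp_rw [h1]
  rw [← Fintype.prod_sum (fun i t => (ZMod.stdAddChar (t * y i) : ℂ))]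
  have h2 : ∀ i, ∑ t : ZMod p, (ZMod.stdAddChar (t * y i) : ℂ)
      = if y i = 0 then (p : ℂ) else 0 := by
    intro i
    have := AddChar.sum_mulShift (y i) (ZMod.isPrimitive_stdAddChar p)
    rw [this]
    simp [ZMod.card]
  simp_rw [h2]
  split_ifs with h
  · subst h; simp
  · obtain ⟨i, hi⟩ := Function.ne_iff.mp h
    exact Finset.prod_eq_zero (mem_univ i) (if_neg hi)

lemma not_even_odd (m : ℕ) (hm : Odd m) (y : ℂ) (hy : IsIntegral ℤ y) (h : (m : ℂ) = 2 * y) :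
    False := by
  obtain ⟨t, rfl⟩ := hm
  have h2 : IsIntegral ℤ (algebraMap ℚ ℂ (1 / 2)) := by
    have : algebraMap ℚ ℂ (1 / 2) = y - (t : ℂ) := by
      push_cast at h
      have : y = t + 1 / 2 := by linear_combination -h / 2
      rw [this]; simp
    rw [this]
    exact hy.sub (isIntegral_nat t)
  have h3 : IsIntegral ℤ (1 / 2 : ℚ) :=
    (isIntegral_algebraMap_iff (algebraMap ℚ ℂ).injective).mp h2
  obtain ⟨z, hz⟩ := IsIntegrallyClosed.isIntegral_iff.mp h3
  have : (2 * z : ℚ) = 1 := by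
    simp at hz
    rw [hz]; norm_num
  have h5 : 2 * z = 1 := by exact_mod_cast this
  omega

/-- Odd order roots of unity that agree mod 2 are equal. -/
lemma root_eq (m : ℕ) (hm : Odd m) (u v y : ℂ) (hu : u ^ m = 1) (hv : v ^ m = 1)
    (hy : IsIntegral ℤ y) (h : u - v = 2 * y) : u = v := by
  by_contra hne
  have hm0 : 0 < m := hm.pos
  have iu : IsIntegral ℤ u := IsIntegral.of_pow hm0 (by rw [hu]; exact isIntegral_one)
  have iv : IsIntegral ℤ v := IsIntegral.of_pow hm0 (by rw [hv]; exact isIntegral_one)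
  let O := integralClosure ℤ ℂ
  let U : O := ⟨u, iu⟩
  let V : O := ⟨v, iv⟩
  let Y : O := ⟨y, hy⟩
  have hUV : U - V = 2 * Y := Subtype.ext h
  have hVm : V ^ m = 1 := Subtype.ext hv
  have h0 : ∑ i ∈ range m, U ^ i * V ^ (m - 1 - i) = 0 := by
    have := (Commute.all u v).geom_sum₂_mul m
    rw [hu, hv, sub_self] at this
    have h' := (mul_eq_zero.mp this).resolve_right (sub_ne_zero.mpr hne)
    apply Subtype.ext
    simpa [U, V] using h'
  let I : Ideal O := Ideal.span {2}
  let q := Ideal.Quotient.mk I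
  have hq : q U = q V := by
    rw [Ideal.Quotient.eq, hUV]
    exact Ideal.mul_mem_right _ _ (Ideal.mem_span_singleton_self _)
  have h1 := congrArg q h0
  simp only [map_sum, map_mul, map_pow, hq, map_zero] at h1
  have h2 : ∀ i ∈ range m, q V ^ i * q V ^ (m - 1 - i) = q V ^ (m - 1) := by
    intro i hi
    have := mem_range.mp hi
    rw [← pow_add]; congr 1; omega
  rw [sum_congr rfl h2, sum_const, card_range, nsmul_eq_mul] at h1
  have h3 : q (m : O) = 0 := by
    have h4 : q V ^ (m - 1) * q V = 1 := by
      rw [← pow_succ, Nat.sub_add_cancel hm0, ← map_pow, hVm, map_one]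
    have := congrArg (· * q V) h1
    simpa [mul_assoc, h4] using this
  rw [Ideal.Quotient.eq_zero_iff_mem, Ideal.mem_span_singleton] at h3
  obtain ⟨z, hz⟩ := h3
  exact not_even_odd m hm z z.2 (by
    have h6 := congrArg (algebraMap O ℂ) hz
    rw [map_mul, map_ofNat] at h6
    simpa using h6)

/-- An even function with values `m`-th roots of unity, `m` odd, on a space of odd characteristic
cannot have sum of squares zero. -/
lemma even_sum {W : Type*} [AddCommGroup W] [Fintype W] [DecidableEq W]
    (hW : ∀ x : W, -x = x → x = 0) (m : ℕ) (hm : 0 < m)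
    (F : W → ℂ) (hF : ∀ x, F x ^ m = 1) (hev : ∀ x, F (-x) = F x)
    (hs : ∑ x, F x ^ 2 = 0) : False := by
  have iF : ∀ x, IsIntegral ℤ (F x) := fun x =>
    IsIntegral.of_pow hm (by rw [hF]; exact isIntegral_one)
  let O := integralClosure ℤ ℂ
  let G : W → O := fun x => ⟨F x, iF x⟩
  let I : Ideal O := Ideal.span {2}
  let q := Ideal.Quotient.mk I
  have hq2 : q 2 = 0 := Ideal.Quotient.eq_zero_iff_mem.mpr (Ideal.mem_span_singleton_self _)
  have hG : ∑ x, G x ^ 2 = 0 := by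
    apply Subtype.ext
    simpa [G] using hs
  have hGe : ∀ x, G (-x) = G x := fun x => Subtype.ext (hev x)
  have h1 : ∑ x ∈ univ.erase (0 : W), q (G x) ^ 2 = 0 := by
    refine Finset.sum_involution (fun x _ => -x) ?_ ?_ ?_ ?_
    · intro x _
      rw [hGe, ← two_mul, ← map_ofNat q 2, hq2, zero_mul]
    · intro x hx _ h
      exact (mem_erase.mp hx).1 (hW x h)
    · intro x hx
      simpa using hx
    · intro x _
      exact neg_neg x
  have h2 := congrArg q hG
  simp only [map_sum, map_pow, map_zero] at h2
  rw [← Finset.sum_erase_add _ _ (mem_univ (0 : W)), h1, zero_add] at h2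
  have h3 : q 1 = 0 := by
    have h4 : (G 0 ^ m) = 1 := Subtype.ext (hF 0)
    have h5 : (G 0 ^ 2) ^ m = 1 := by rw [← pow_mul, mul_comm, pow_mul, h4, one_pow]
    rw [← h5, map_pow, map_pow, h2, zero_pow hm.ne']
  rw [Ideal.Quotient.eq_zero_iff_mem, Ideal.mem_span_singleton] at h3
  obtain ⟨z, hz⟩ := h3
  exact not_even_odd 1 odd_one z z.2 (by
    have h6 := congrArg (algebraMap O ℂ) hz
    rw [map_mul, map_ofNat] at h6
    simpa using h6)

theorem stmt_9 (p k n : ℕ) [NeZero p] [NeZero (p ^ k)] (hp : p.Prime) (hp3 : p % 4 = 3)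
    (hk : 1 ≤ k) (hn : Odd n) :
    ¬ ∃ (f : (Fin n → ZMod p) → ZMod (p ^ k)) (ε : (Fin n → ZMod p) → ℂ),
        (∀ a, ε a = 1 ∨ ε a = -1) ∧
        ∀ a, walsh p k n f a =
          Complex.I * ε a * (Real.sqrt ((p : ℝ) ^ n) : ℂ) * chr (p ^ k) (f a) := by
  rintro ⟨f, ε, hε, hw⟩
  have := Fact.mk hp
  have hpodd : Odd p := Nat.odd_iff.mpr (by omega)
  set F : (Fin n → ZMod p) → ℂ := fun x => chr (p ^ k) (f x) with hFdef
  have hFm : ∀ x, F x ^ (p ^ k) = 1 := fun x => chr_pow _ _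
  have hFi : ∀ x, IsIntegral ℤ (F x) := fun x => chr_integral _ _
  set c : ℂ := Complex.I * (Real.sqrt ((p : ℝ) ^ n) : ℂ) with hc
  have hc2 : c * c = -(p : ℂ) ^ n := by
    have h : ((Real.sqrt ((p : ℝ) ^ n) : ℂ)) * (Real.sqrt ((p : ℝ) ^ n) : ℂ) = (p : ℂ) ^ n := by
      rw [← Complex.ofReal_mul, Real.mul_self_sqrt (by positivity)]
      push_cast; rfl
    rw [hc]
    linear_combination (Complex.I * Complex.I) * h + (p : ℂ) ^ n * Complex.I_mul_I
  have hpn0 : (p : ℂ) ^ n ≠ 0 := pow_ne_zero _ (by exact_mod_cast hp.ne_zero)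
  have hc0 : c ≠ 0 := by
    intro h; rw [h] at hc2; apply hpn0; linear_combination hc2
  have hci : IsIntegral ℤ c := by
    apply IsIntegral.of_pow (n := 2) (by norm_num)
    rw [pow_two, hc2]
    exact ((isIntegral_nat p).pow n).neg
  let χ : (Fin n → ZMod p) → (Fin n → ZMod p) → ℂ := fun a x => chr p (-(∑ i, a i * x i))
  have hχs : ∀ a x, χ a x = χ x a := by
    intro a x; simp only [χ, mul_comm]
  have hχi : ∀ a x, IsIntegral ℤ (χ a x) := fun a x => chr_integral _ _
  have hH : ∀ a, ∑ x, F x * χ a x = c * ε a * F a := by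
    intro a
    have := hw a
    rw [walsh] at this
    rw [hc]
    refine this.trans ?_
    ring
  have hε2 : ∀ a, ε a * ε a = 1 := by
    intro a; rcases hε a with h | h <;> rw [h] <;> norm_num
  have horth : ∀ x y, ∑ a, χ a x * χ a y = if x = -y then (p : ℂ) ^ n else 0 := by
    intro x y
    have h1 : ∀ a, χ a x * χ a y = chr p (∑ i, a i * (-(x + y)) i) := by
      intro a
      simp only [χ, chr_eq]
      rw [← AddChar.map_add_eq_mul]
      congr 1
      rw [← neg_add, ← sum_add_distrib, ← sum_neg_distrib]
      apply sum_congr rfl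
      intro i _
      simp; ring
    simp_rw [h1]
    rw [sum_orth p n hp]
    simp only [neg_eq_zero, add_eq_zero_iff_eq_neg]
  -- the transform of `ε F`
  have hG : ∀ y, ∑ a, ε a * F a * χ a y = -c * F (-y) := by
    intro y
    have h1 : ∑ a, (∑ x, F x * χ a x) * χ a y = (p : ℂ) ^ n * F (-y) := by
      simp_rw [sum_mul]
      rw [sum_comm]
      simp_rw [mul_assoc, ← mul_sum, horth]
      simp [mul_comm]
    simp_rw [hH] at h1
    have h2 : c * ∑ a, ε a * F a * χ a y = (p : ℂ) ^ n * F (-y) := by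
      rw [← h1, mul_sum]
      apply sum_congr rfl
      intro a _; ring
    apply mul_left_cancel₀ hc0
    rw [h2]
    linear_combination F (-y) * hc2
  have hodd : Odd (p ^ n) := hpodd.pow
  obtain ⟨t, ht⟩ := hodd
  have htC : (p : ℂ) ^ n = 2 * t + 1 := by exact_mod_cast ht
  have iNat : ∀ j : ℕ, IsIntegral ℤ (j : ℂ) := isIntegral_nat
  -- `F` is even
  have hev : ∀ y, F (-y) = F y := by
    intro y
    let e : (Fin n → ZMod p) → ℂ := fun a => if ε a = 1 then 1 else 0
    have he : ∀ a, ε a = 2 * e a - 1 := by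
      intro a
      rcases hε a with h | h
      · simp [e, h]; norm_num
      · have : (-1 : ℂ) ≠ 1 := by norm_num
        simp [e, h, this]
    have hei : ∀ a, IsIntegral ℤ (e a) := by
      intro a
      simp only [e]
      split_ifs
      · exact isIntegral_one
      · exact isIntegral_zero
    have hA : 2 * ∑ a, e a * F a * χ a y = c * (ε y * F y - F (-y)) := by
      have h1 := hH y
      have h2 := hG y
      have : 2 * ∑ a, e a * F a * χ a y
          = ∑ x, F x * χ y x + ∑ a, ε a * F a * χ a y := by
        rw [mul_sum, ← sum_add_distrib]
        apply sum_congr rfl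
        intro a _
        rw [hχs y a, he a]; ring
      rw [this, h1, h2]; ring
    set A := ∑ a, e a * F a * χ a y with hAdef
    have hAi : IsIntegral ℤ A :=
      IsIntegral.sum _ fun a _ => ((hei a).mul (hFi a)).mul (hχi a y)
    refine root_eq (p ^ k) hpodd.pow (F (-y)) (F y)
      (c * A + (t : ℂ) * (ε y * F y - F (-y)) + e y * F y - F y) (hFm _) (hFm _) ?_ ?_
    · have hεi : IsIntegral ℤ (ε y) := by
        rcases hε y with h | h <;> rw [h]
        · exact isIntegral_one
        · exact isIntegral_one.neg
      exact (((hci.mul hAi).add ((iNat t).mul ((hεi.mul (hFi y)).sub (hFi _)))).add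
        ((hei y).mul (hFi y))).sub (hFi y)
    · have h3 : c * (2 * A) = -(2 * t + 1) * (ε y * F y - F (-y)) := by
        rw [hA, ← mul_assoc, hc2, htC]
      linear_combination -h3 + F y * he y
  -- sum of squares vanishes
  have hsq : ∑ x, F x ^ 2 = 0 := by
    have h1 : ∑ a, (∑ x, F x * χ a x) * (ε a * F a) = c * ∑ a, F a ^ 2 := by
      simp_rw [hH]
      rw [mul_sum]
      apply sum_congr rfl
      intro a _
      linear_combination c * F a ^ 2 * hε2 a
    have h2 : ∑ a, (∑ x, F x * χ a x) * (ε a * F a) = -c * ∑ a, F a ^ 2 := by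
      simp_rw [sum_mul]
      rw [sum_comm, mul_sum]
      apply sum_congr rfl
      intro x _
      have := hG x
      rw [hev] at this
      calc ∑ a, F x * χ a x * (ε a * F a) = F x * ∑ a, ε a * F a * χ a x := by
            rw [mul_sum]; apply sum_congr rfl; intro a _; ring
        _ = _ := by rw [this]; ring
    have h3 : c * ∑ a, F a ^ 2 = 0 := by linear_combination (h2 - h1) / 2
    exact (mul_eq_zero.mp h3).resolve_left hc0
  refine even_sum ?_ (p ^ k) (Nat.pos_of_ne_zero (NeZero.ne _)) F hFm hev hsq
  intro x hx
  funext i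
  have h := congrFun hx i
  have h2 : (2 : ZMod p) ≠ 0 := by
    intro h
    have h' : ((2 : ℕ) : ZMod p) = 0 := by exact_mod_cast h
    rw [ZMod.natCast_eq_zero_iff] at h'
    have := Nat.le_of_dvd (by norm_num) h'
    omega
  have h4 : 2 * x i = 0 := by
    simp only [Pi.neg_apply] at h
    linear_combination -h
  exact (mul_eq_zero.mp h4).resolve_left h2
end

section
/- Let p be an odd prime and define the quadratic Gauss sum G = Σ_{i ∈ F_p^*} η(i) ζ_p^i, where η is the quadratic character of F_p. Then ξ √p = G, where ξ = 1 if p ≡ 1 (mod 4) and ξ = √−1 if p ≡ 3 (mod 4); in particular ξ √p ∈ Z[ζ_p]. -/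
open Finset

open Polynomial in
lemma aux_euler_pow {R : Type*} [CommRing R] (N n : ℕ) (hn : n ≤ N) :
    ∃ h : R[X], (fun f : R[X] => X * derivative f)^[n] ((X - 1) ^ N) = (X - 1) ^ (N - n) * h ∧
      h.eval 1 = ∏ i ∈ range n, ((N : R) - i) := by
  induction n with
  | zero => exact ⟨1, by simp⟩
  | succ n ih =>
    obtain ⟨h, h1, h2⟩ := ih (by omega)
    obtain ⟨d, rfl⟩ : ∃ d, N = n + 1 + d := ⟨N - (n + 1), by omega⟩
    have e1 : n + 1 + d - n = d + 1 := by omega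
    have e2 : n + 1 + d - (n + 1) = d := by omega
    rw [e1] at h1
    rw [e2]
    refine ⟨X * (((d : R[X]) + 1) * h + (X - 1) * derivative h), ?_, ?_⟩
    · rw [Function.iterate_succ_apply', h1]
      simp only [derivative_mul, derivative_pow, derivative_sub, derivative_X, derivative_one, Nat.add_sub_cancel]
      simp
      ring
    · rw [prod_range_succ, ← h2]
      simp
      ring

open Polynomial in
lemma aux_euler_sum {R : Type*} [CommRing R] (p n : ℕ) :
    (fun f : R[X] => X * derivative f)^[n] (∑ j ∈ range p, X ^ j) =
      ∑ j ∈ range p, C ((j : R) ^ n) * X ^ j := by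
  induction n with
  | zero => simp
  | succ n ih =>
    rw [Function.iterate_succ_apply', ih]
    simp only [derivative_sum, mul_sum]
    refine sum_congr rfl fun j _ => ?_
    rcases j with _ | j
    · rw [derivative_C_mul]
      simp
    · rw [derivative_C_mul_X_pow, Nat.add_sub_cancel, pow_succ (((j + 1 : ℕ) : R)) n, pow_succ X j]
      ring

open Polynomial in
lemma aux_prod {R : Type*} [CommRing R] (m : ℕ) :
    ∃ h : R[X], ∏ k ∈ range m, (X ^ ((k + 1) * m) * (1 - X ^ (k + 1)) : R[X]) = (X - 1) ^ m * h ∧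
      h.eval 1 = ∏ k ∈ range m, (-((k : R) + 1)) := by
  refine ⟨∏ k ∈ range m, (X ^ ((k + 1) * m) * (-∑ i ∈ range (k + 1), X ^ i)), ?_, ?_⟩
  · have : (X - 1 : R[X]) ^ m = ∏ k ∈ range m, (X - 1) := by simp
    rw [this, ← prod_mul_distrib]
    refine prod_congr rfl fun k _ => ?_
    have := geom_sum_mul (X : R[X]) (k + 1)
    linear_combination (X ^ ((k + 1) * m)) * this
  · simp [eval_prod, eval_finsetSum]

open Polynomial in
lemma aux_sign (m : ℕ) (hm : 1 ≤ m) (hp : Fact (2 * m + 1).Prime) (ζ : ℂ)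
    (hζ : IsPrimitiveRoot ζ (2 * m + 1)) (ε : ℤ) (hε : ε = 1 ∨ ε = -1)
    (h : ∑ j ∈ range (2 * m + 1), (quadraticChar (ZMod (2 * m + 1)) j : ℂ) * ζ ^ j =
      ε * ∏ k ∈ range m, (ζ ^ ((k + 1) * m) * (1 - ζ ^ (k + 1)))) : ε = 1 := by
  have hchar : ringChar (ZMod (2 * m + 1)) ≠ 2 := by
    rw [ZMod.ringChar_zmod_n]; omega
  set f : ℤ[X] := ∑ j ∈ range (2 * m + 1), C (quadraticChar (ZMod (2 * m + 1)) j) * X ^ j -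
    C ε * ∏ k ∈ range m, (X ^ ((k + 1) * m) * (1 - X ^ (k + 1))) with hf
  have hroot : aeval ζ f = 0 := by
    simp only [hf, map_sub, map_sum, map_mul, map_prod, map_pow, aeval_X, map_one, aeval_C]
    simpa [sub_eq_zero] using h
  have hdvd : cyclotomic (2 * m + 1) ℤ ∣ f := by
    rw [cyclotomic_eq_minpoly hζ (by omega)]
    exact minpoly.isIntegrallyClosed_dvd (hζ.isIntegral (by omega)) hroot
  have hcyc : cyclotomic (2 * m + 1) (ZMod (2 * m + 1)) = (X - 1) ^ (2 * m) := by
    have := cyclotomic_mul_prime_eq_pow_of_not_dvd (ZMod (2 * m + 1)) (p := 2 * m + 1) (n := 1)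
      (by simp; omega)
    simpa using this
  obtain ⟨g, hg⟩ := hdvd
  have hg' := congrArg (Polynomial.map (Int.castRingHom (ZMod (2 * m + 1)))) hg
  rw [Polynomial.map_mul, map_cyclotomic_int, hcyc] at hg'
  have hterm : ∀ j : ℕ, ((quadraticChar (ZMod (2 * m + 1)) j : ℤ) : ZMod (2 * m + 1)) =
      (j : ZMod (2 * m + 1)) ^ m := by
    intro j
    have := quadraticChar_eq_pow_of_char_ne_two' hchar (j : ZMod (2 * m + 1))
    rwa [ZMod.card, show (2 * m + 1) / 2 = m by omega] at this
  have hfm : f.map (Int.castRingHom (ZMod (2 * m + 1))) =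
      (∑ j ∈ range (2 * m + 1), C ((j : ZMod (2 * m + 1)) ^ m) * X ^ j) -
      C (ε : ZMod (2 * m + 1)) * ∏ k ∈ range m, (X ^ ((k + 1) * m) * (1 - X ^ (k + 1))) := by
    rw [hf]
    simp only [Polynomial.map_sub, Polynomial.map_sum, Polynomial.map_mul, Polynomial.map_prod,
      Polynomial.map_pow, map_X, Polynomial.map_one, map_C,
      Int.coe_castRingHom, hterm]
  rw [hfm, ← aux_euler_sum, ← cyclotomic_prime, hcyc] at hg'
  obtain ⟨A, hA, hA1⟩ := aux_euler_pow (R := ZMod (2 * m + 1)) (2 * m) m (by omega)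
  obtain ⟨B, hB, hB1⟩ := aux_prod (R := ZMod (2 * m + 1)) m
  rw [hA, hB, show 2 * m - m = m by omega] at hg'
  have hX : (X - 1 : (ZMod (2 * m + 1))[X]) ≠ 0 := X_sub_C_ne_zero 1
  have h3 : A - C (ε : ZMod (2 * m + 1)) * B =
      (X - 1) ^ m * g.map (Int.castRingHom (ZMod (2 * m + 1))) := by
    apply mul_left_cancel₀ (pow_ne_zero m hX)
    linear_combination hg'
  have h4 := congrArg (eval 1) h3
  have hAB : A.eval 1 = B.eval 1 := by
    rw [hA1, hB1]
    refine prod_congr rfl fun i _ => ?_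
    have : ((2 * m + 1 : ℕ) : ZMod (2 * m + 1)) = 0 := ZMod.natCast_self _
    push_cast at this ⊢
    linear_combination this
  have hB0 : B.eval 1 ≠ 0 := by
    rw [hB1, prod_ne_zero_iff]
    intro k hk
    rw [mem_range] at hk
    rw [neg_ne_zero]
    intro h0
    have : ((k + 1 : ℕ) : ZMod (2 * m + 1)) = 0 := by exact_mod_cast h0
    rw [ZMod.natCast_eq_zero_iff] at this
    have := Nat.le_of_dvd (by omega) this
    omega
  rcases hε with rfl | rfl
  · rfl
  · exfalso
    simp [hAB, zero_pow (show m ≠ 0 by omega)] at h4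
    have h5 : (2 : ZMod (2 * m + 1)) * B.eval 1 = 0 := by linear_combination h4
    rcases mul_eq_zero.mp h5 with h6 | h6
    · have : ((2 : ℕ) : ZMod (2 * m + 1)) = 0 := by exact_mod_cast h6
      rw [ZMod.natCast_eq_zero_iff] at this
      have := Nat.le_of_dvd (by omega) this
      omega
    · exact hB0 h6

lemma aux_c (m : ℕ) : ∏ k ∈ range m, ((-1 : ℂ) ^ (k + 1) * (-Complex.I)) =
    if m % 2 = 0 then 1 else Complex.I := by
  induction m with
  | zero => simp
  | succ m ih =>
    rw [prod_range_succ, ih]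
    rcases Nat.even_or_odd m with h | h
    · have h1 := Nat.even_iff.mp h
      rw [if_pos h1, if_neg (by omega), h.add_one.neg_one_pow]
      ring
    · have h1 := Nat.odd_iff.mp h
      rw [if_neg (by omega), if_pos (by omega), h.add_one.neg_one_pow]
      linear_combination -Complex.I_mul_I

lemma aux_one_sub (m k : ℕ) :
    1 - Complex.exp (2 * Real.pi * Complex.I / ((2 * m + 1 : ℕ) : ℂ)) ^ k =
      Complex.exp (Real.pi * k / ((2 * m + 1 : ℕ) : ℂ) * Complex.I) * (-Complex.I) *
        ((2 * Real.sin (Real.pi * k / (2 * m + 1 : ℕ)) : ℝ) : ℂ) := by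
  have hp : ((2 * m + 1 : ℕ) : ℂ) ≠ 0 := Nat.cast_ne_zero.mpr (by omega)
  set x : ℂ := Real.pi * k / ((2 * m + 1 : ℕ) : ℂ) with hx
  have h1 : Complex.exp (2 * Real.pi * Complex.I / ((2 * m + 1 : ℕ) : ℂ)) ^ k =
      Complex.exp (x * Complex.I) * Complex.exp (x * Complex.I) := by
    rw [← Complex.exp_nat_mul, ← Complex.exp_add]
    congr 1
    rw [hx]; ring
  have h2 : Complex.exp (x * Complex.I) * Complex.exp (-x * Complex.I) = 1 := by
    rw [← Complex.exp_add]; simp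
  have h3 : ((2 * Real.sin (Real.pi * k / (2 * m + 1 : ℕ)) : ℝ) : ℂ) =
      (Complex.exp (-x * Complex.I) - Complex.exp (x * Complex.I)) * Complex.I := by
    rw [hx]
    push_cast
    rw [Complex.sin]
    ring
  rw [h1, h3]
  linear_combination (-1 : ℂ) * h2 + (Complex.exp (x * Complex.I) * (Complex.exp (-x * Complex.I) - Complex.exp (x * Complex.I))) * Complex.I_mul_I

lemma aux_sin_pos (m k : ℕ) (hk : k < 2 * m) :
    0 < 2 * Real.sin (Real.pi * (k + 1 : ℕ) / (2 * m + 1 : ℕ)) := by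
  have hp : (0 : ℝ) < (2 * m + 1 : ℕ) := by positivity
  have := Real.pi_pos
  refine mul_pos two_pos (Real.sin_pos_of_pos_of_lt_pi (by positivity) ?_)
  rw [div_lt_iff₀ hp]
  have : ((k + 1 : ℕ) : ℝ) < (2 * m + 1 : ℕ) := Nat.cast_lt.mpr (by omega)
  gcongr

lemma aux_sin_prod (m : ℕ) :
    ∏ k ∈ range m, (2 * Real.sin (Real.pi * (k + 1 : ℕ) / (2 * m + 1 : ℕ))) =
      Real.sqrt (2 * m + 1 : ℕ) := by
  have hp : ((2 * m + 1 : ℕ) : ℝ) ≠ 0 := by positivity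
  have hζ := Complex.isPrimitiveRoot_exp (2 * m + 1) (by omega)
  have h1 := congrArg norm (hζ.prod_one_sub_pow_eq_order)
  rw [norm_prod] at h1
  have h2 : ∀ k ∈ range (2 * m),
      ‖1 - Complex.exp (2 * Real.pi * Complex.I / ((2 * m + 1 : ℕ) : ℂ)) ^ (k + 1)‖ =
      2 * Real.sin (Real.pi * (k + 1 : ℕ) / (2 * m + 1 : ℕ)) := by
    intro k hk
    have h := aux_sin_pos m k (mem_range.mp hk)
    rw [aux_one_sub, norm_mul, norm_mul, Complex.norm_real, Real.norm_of_nonneg h.le]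
    have : Complex.exp (Real.pi * (k + 1 : ℕ) / ((2 * m + 1 : ℕ) : ℂ) * Complex.I) =
      Complex.exp ((Real.pi * (k + 1 : ℕ) / ((2 * m + 1 : ℕ) : ℝ) : ℝ) * Complex.I) := by
      push_cast; rfl
    rw [this, Complex.norm_exp_ofReal_mul_I]
    simp
  rw [prod_congr rfl h2, two_mul, prod_range_add] at h1
  have h3 : ∏ x ∈ range m, (2 * Real.sin (Real.pi * (m + x + 1 : ℕ) / (m + m + 1 : ℕ))) =
      ∏ k ∈ range m, (2 * Real.sin (Real.pi * (k + 1 : ℕ) / (m + m + 1 : ℕ))) := by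
    rw [← prod_range_reflect]
    refine prod_congr rfl fun k hk => ?_
    rw [mem_range] at hk
    rw [← Real.sin_pi_sub]
    congr 2
    rw [two_mul] at hp
    have : ((m + (m - 1 - k) + 1 : ℕ) : ℝ) = (m + m + 1 : ℕ) - (k + 1 : ℕ) := by
      rw [eq_sub_iff_add_eq]; exact_mod_cast (by omega)
    rw [this]
    field_simp
    ring
  rw [h3] at h1
  symm
  rw [two_mul, Real.sqrt_eq_iff_mul_self_eq (by positivity)]
  · rw [h1, ← Nat.cast_add_one, Complex.norm_natCast]
  · refine prod_nonneg fun k hk => ?_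
    have := aux_sin_pos m k (by rw [mem_range] at hk; omega)
    rw [two_mul m] at this
    exact this.le

lemma aux_P (m : ℕ) :
    ∏ k ∈ range m, (Complex.exp (2 * Real.pi * Complex.I / ((2 * m + 1 : ℕ) : ℂ)) ^ ((k + 1) * m) *
      (1 - Complex.exp (2 * Real.pi * Complex.I / ((2 * m + 1 : ℕ) : ℂ)) ^ (k + 1))) =
    (if m % 2 = 0 then 1 else Complex.I) * (Real.sqrt (2 * m + 1 : ℕ) : ℂ) := by
  have hp : ((2 * m + 1 : ℕ) : ℂ) ≠ 0 := Nat.cast_ne_zero.mpr (by omega)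
  rw [← aux_c, ← aux_sin_prod, Complex.ofReal_prod, ← prod_mul_distrib]
  refine prod_congr rfl fun k _ => ?_
  rw [aux_one_sub, ← mul_assoc, ← mul_assoc]
  congr 2
  rw [← Complex.exp_pi_mul_I, ← Complex.exp_nat_mul, ← Complex.exp_nat_mul, ← Complex.exp_add]
  congr 1
  field_simp
  push_cast
  ring

lemma aux_chr (p : ℕ) [NeZero p] (i : ZMod p) :
    chr p i = Complex.exp (2 * Real.pi * Complex.I / (p : ℂ)) ^ i.val := by
  rw [chr, ← Complex.exp_nat_mul]
  congr 1
  ring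

lemma aux_std (p : ℕ) [NeZero p] (i : ZMod p) : ZMod.stdAddChar i = chr p i := by
  rw [ZMod.stdAddChar_apply, ZMod.toCircle_apply, chr]

lemma aux_main (p : ℕ) [NeZero p] [Fact p.Prime] (hodd : Odd p) :
    (if p % 4 = 1 then (1 : ℂ) else Complex.I) * (Real.sqrt p : ℂ) =
      ∑ i : ZMod p, (quadraticChar (ZMod p) i : ℂ) * chr p i := by
  have hP : Fact p.Prime := inferInstance
  obtain ⟨m, rfl⟩ := hodd
  have hm : 1 ≤ m := by
    have := hP.out.one_lt
    omega
  have hchar : ringChar (ZMod (2 * m + 1)) ≠ 2 := by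
    rw [ZMod.ringChar_zmod_n]; omega
  set ξ : ℂ := if (2 * m + 1) % 4 = 1 then (1 : ℂ) else Complex.I with hξ
  set G := ∑ i : ZMod (2 * m + 1), (quadraticChar (ZMod (2 * m + 1)) i : ℂ) * chr (2 * m + 1) i
    with hG
  have hξ' : ξ = if m % 2 = 0 then 1 else Complex.I := by
    rw [hξ]
    congr 1
    rw [eq_iff_iff]
    omega
  have hsq : G ^ 2 = (ξ * (Real.sqrt (2 * m + 1 : ℕ) : ℂ)) ^ 2 := by
    have hinj : Function.Injective (Int.castRingHom ℂ) := Int.cast_injective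
    have h1 := gaussSum_sq (χ := (quadraticChar (ZMod (2 * m + 1))).ringHomComp (Int.castRingHom ℂ))
      ((MulChar.ringHomComp_ne_one_iff hinj).mpr (quadraticChar_ne_one hchar))
      ((quadraticChar_isQuadratic _).comp _) (ZMod.isPrimitive_stdAddChar (2 * m + 1))
    have h2 : gaussSum ((quadraticChar (ZMod (2 * m + 1))).ringHomComp (Int.castRingHom ℂ))
        ZMod.stdAddChar = G := by
      rw [gaussSum, hG]
      refine sum_congr rfl fun i _ => ?_
      rw [aux_std]
      simp
    rw [h2] at h1
    rw [h1, mul_pow, ← Complex.ofReal_pow, Real.sq_sqrt (by positivity), ZMod.card]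
    rw [MulChar.ringHomComp_apply, quadraticChar_neg_one hchar, ZMod.card,
      ZMod.χ₄_nat_eq_if_mod_four]
    rw [if_neg (by omega), hξ]
    split_ifs <;> simp
  have hsum : G = ∑ j ∈ range (2 * m + 1), (quadraticChar (ZMod (2 * m + 1)) j : ℂ) *
      Complex.exp (2 * Real.pi * Complex.I / ((2 * m + 1 : ℕ) : ℂ)) ^ j := by
    rw [hG]
    refine sum_bij (fun i _ => i.val) ?_ ?_ ?_ ?_
    · intro i _
      exact mem_range.mpr (ZMod.val_lt i)
    · intro i _ j _ h
      exact ZMod.val_injective _ h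
    · intro j hj
      exact ⟨(j : ZMod (2 * m + 1)), mem_univ _, ZMod.val_cast_of_lt (mem_range.mp hj)⟩
    · intro i _
      rw [aux_chr, ZMod.natCast_zmod_val]
  have hPm := aux_P m
  rw [← hξ'] at hPm
  have hζ := Complex.isPrimitiveRoot_exp (2 * m + 1) (by omega)
  rcases sq_eq_sq_iff_eq_or_eq_neg.mp hsq with h | h
  · exact h.symm
  · exfalso
    have := aux_sign m hm hP _ hζ (-1) (Or.inr rfl) (by
      rw [hPm, ← hsum, h]; push_cast; ring)
    norm_num at this

theorem stmt_12 (p : ℕ) [NeZero p] [Fact p.Prime] (hodd : Odd p) :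
    (if p % 4 = 1 then (1 : ℂ) else Complex.I) * (Real.sqrt p : ℂ) =
      (∑ i ∈ Finset.univ.filter (fun i : ZMod p => i ≠ 0),
        (quadraticChar (ZMod p) i : ℂ) * chr p i) ∧
    (if p % 4 = 1 then (1 : ℂ) else Complex.I) * (Real.sqrt p : ℂ) ∈
      Algebra.adjoin ℤ ({chr p 1} : Set ℂ) := by
  rw [aux_main p hodd]
  have hP : Fact p.Prime := inferInstance
  have h1 : Fact (1 < p) := ⟨hP.out.one_lt⟩
  constructor
  · rw [sum_filter]
    refine sum_congr rfl fun i _ => ?_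
    by_cases hi : i = 0
    · simp [hi]
    · simp [hi]
  · refine Subalgebra.sum_mem _ fun i _ => Subalgebra.mul_mem _ (Subalgebra.intCast_mem _ _) ?_
    have h2 : chr p i = chr p 1 ^ i.val := by
      rw [aux_chr p i, aux_chr p 1, ZMod.val_one, pow_one]
    rw [h2]
    exact Subalgebra.pow_mem _ (Algebra.subset_adjoin (Set.mem_singleton _)) _
end
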